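/- Let L be a symmetric real N×N matrix with L·1 = 0, and suppose there exist λ_G > 0 with wᵀ L w ≥ λ_G ‖w‖² for every w ∈ ℝ^N with 1ᵀw = 0, and Λ > 0 with ‖L w‖ ≤ Λ‖w‖ for all w ∈ ℝ^N. Let k > 0, let d : ℝ → ℝ^{Nn} be continuous with ‖d(t)‖ ≤ δ for all t ≥ 0, and let r : [0,∞) → ℝ^{Nn} be differentiable with r(0) = 0 and r'(t) = −k (L ⊗ Iₙ) r(t) + k (L ⊗ Iₙ) d(t) for all t ≥ 0. Then: (a) writing r(t) in N blocks r₁(t),…,r_N(t) ∈ ℝⁿ, one has Σᵢ rᵢ(t) = 0 for all t ≥ 0; and (b) for every ρ > Λ δ / λ_G there exists a finite time T_ρ ≥ 0 such that ‖r(t)‖ ≤ ρ for all t ≥ T_ρ. -/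

import Mathlib

open Matrix
open scoped Kronecker

/-- The Euclidean norm of a finitely-indexed real vector. -/
noncomputable def euclNorm {ι : Type*} [Fintype ι] (v : ι → ℝ) : ℝ :=
  Real.sqrt (∑ i, v i ^ 2)

lemma euclNorm_sq {ι : Type*} [Fintype ι] (v : ι → ℝ) :
    euclNorm v ^ 2 = ∑ i, v i ^ 2 :=
  Real.sq_sqrt (Finset.sum_nonneg fun i _ => sq_nonneg (v i))

lemma euclNorm_nonneg {ι : Type*} [Fintype ι] (v : ι → ℝ) : 0 ≤ euclNorm v :=
  Real.sqrt_nonneg _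

lemma kronecker_one_mulVec_apply {ι κ : Type*} [Fintype ι] [Fintype κ] [DecidableEq κ]
    (L : Matrix ι ι ℝ) (v : ι × κ → ℝ) (i : ι) (a : κ) :
    (L ⊗ₖ (1 : Matrix κ κ ℝ)).mulVec v (i, a) = L.mulVec (fun j => v (j, a)) i := by
  simp [Matrix.mulVec, dotProduct, Fintype.sum_prod_type, Matrix.one_apply]

lemma sum_mulVec_eq_zero_of_isSymm {ι : Type*} [Fintype ι] {L : Matrix ι ι ℝ}
    (hsym : L.IsSymm) (hL1 : L.mulVec (fun _ => (1 : ℝ)) = 0) (w : ι → ℝ) :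
    ∑ i, L.mulVec w i = 0 := by
  have h : (fun _ : ι => (1 : ℝ)) ⬝ᵥ L.mulVec w = 0 := by
    rw [Matrix.dotProduct_mulVec, ← Matrix.mulVec_transpose, hsym.eq, hL1, zero_dotProduct]
  simpa [dotProduct] using h

/-- A Lyapunov gap transfers from `L` to `L ⊗ I` on vectors whose blocks sum to zero. -/
lemma le_dotProduct_kronecker_one_mulVec {ι κ : Type*} [Fintype ι] [Fintype κ] [DecidableEq κ]
    {L : Matrix ι ι ℝ} {lamG : ℝ}
    (hgap : ∀ w : ι → ℝ, (∑ i, w i) = 0 → lamG * (∑ i, w i ^ 2) ≤ w ⬝ᵥ L.mulVec w)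
    (v : ι × κ → ℝ) (hv : ∀ a, ∑ i, v (i, a) = 0) :
    lamG * ∑ p, v p ^ 2 ≤ ∑ p, v p * (L ⊗ₖ (1 : Matrix κ κ ℝ)).mulVec v p := by
  simp only [Fintype.sum_prod_type_right, kronecker_one_mulVec_apply, Finset.mul_sum]
  refine Finset.sum_le_sum fun a _ => ?_
  simpa only [dotProduct, Finset.mul_sum] using hgap (fun i => v (i, a)) (hv a)

lemma sum_sq_kronecker_one_mulVec_le {ι κ : Type*} [Fintype ι] [Fintype κ] [DecidableEq κ]
    {L : Matrix ι ι ℝ} {Lam : ℝ}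
    (hop : ∀ w : ι → ℝ, euclNorm (L.mulVec w) ≤ Lam * euclNorm w) (v : ι × κ → ℝ) :
    ∑ p, (L ⊗ₖ (1 : Matrix κ κ ℝ)).mulVec v p ^ 2 ≤ Lam ^ 2 * ∑ p, v p ^ 2 := by
  simp only [Fintype.sum_prod_type_right, kronecker_one_mulVec_apply]
  rw [Finset.mul_sum]
  refine Finset.sum_le_sum fun a _ => ?_
  have h := pow_le_pow_left₀ (euclNorm_nonneg _) (hop fun i => v (i, a)) 2
  rwa [mul_pow, euclNorm_sq, euclNorm_sq] at h

lemma antitoneOn_Ici_of_hasDerivWithinAt_nonpos {f f' : ℝ → ℝ} {a : ℝ}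
    (hf : ∀ t ≥ a, HasDerivWithinAt f (f' t) (Set.Ici a) t) (hf' : ∀ t ≥ a, f' t ≤ 0) :
    AntitoneOn f (Set.Ici a) :=
  antitoneOn_of_hasDerivWithinAt_nonpos (convex_Ici a)
    (fun t ht => (hf t ht).continuousWithinAt)
    (fun t ht => (hf t (interior_subset ht)).mono interior_subset)
    (fun t ht => hf' t (interior_subset ht))

/-- Comparison principle: `V' ≤ -μ (V - c)` keeps `V` below `c` once it starts there. -/
lemma le_of_hasDerivWithinAt_le_neg_mul_sub {V V' : ℝ → ℝ} {c μ : ℝ} (h0 : V 0 ≤ c)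
    (hV : ∀ t ≥ 0, HasDerivWithinAt V (V' t) (Set.Ici 0) t)
    (hV' : ∀ t ≥ 0, V' t ≤ -μ * (V t - c)) {t : ℝ} (ht : 0 ≤ t) : V t ≤ c := by
  have hderiv : ∀ s ≥ (0 : ℝ), HasDerivWithinAt (fun s => (V s - c) * Real.exp (μ * s))
      (V' s * Real.exp (μ * s) + (V s - c) * (Real.exp (μ * s) * (μ * 1))) (Set.Ici 0) s :=
    fun s hs => ((hV s hs).sub_const c).mul
      (((hasDerivAt_id s).const_mul μ).exp.hasDerivWithinAt)
  have hanti := antitoneOn_Ici_of_hasDerivWithinAt_nonpos hderiv fun s hs => by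
    nlinarith [mul_le_mul_of_nonneg_right (hV' s hs) (Real.exp_pos (μ * s)).le]
  have h := hanti Set.self_mem_Ici ht ht
  simp only [mul_zero, Real.exp_zero, mul_one] at h
  have := nonpos_of_mul_nonpos_left (h.trans (sub_nonpos.2 h0)) (Real.exp_pos (μ * t))
  linarith

/-- (Quantization residual dynamics.)
For `r' = −k (L⊗Iₙ) r + k (L⊗Iₙ) d` with `r(0) = 0` and `‖d(t)‖ ≤ δ`:
(a) the blocks of `r(t)` sum to zero for all `t ≥ 0`; and (b) for every
`ρ > Λ δ / λ_G` the norm `‖r(t)‖` eventually stays below `ρ`. -/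
theorem quantization_residual_dynamics (N n : ℕ)
    (L : Matrix (Fin N) (Fin N) ℝ) (hsym : L.IsSymm)
    (hL1 : L.mulVec (fun _ => (1 : ℝ)) = 0)
    (lamG Lam k δ : ℝ) (hlamG : 0 < lamG) (hLam : 0 < Lam) (hk : 0 < k)
    (hgap : ∀ w : Fin N → ℝ, (∑ i, w i) = 0 →
      lamG * (∑ i, w i ^ 2) ≤ w ⬝ᵥ L.mulVec w)
    (hop : ∀ w : Fin N → ℝ, euclNorm (L.mulVec w) ≤ Lam * euclNorm w)
    (d : ℝ → (Fin N × Fin n → ℝ)) (hdcont : Continuous d)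
    (hdbound : ∀ t ≥ (0 : ℝ), euclNorm (d t) ≤ δ)
    (r : ℝ → (Fin N × Fin n → ℝ)) (hr0 : r 0 = 0)
    (hr : ∀ t ≥ (0 : ℝ), HasDerivWithinAt r
      (-(k • ((L ⊗ₖ (1 : Matrix (Fin n) (Fin n) ℝ)).mulVec (r t))) +
        k • ((L ⊗ₖ (1 : Matrix (Fin n) (Fin n) ℝ)).mulVec (d t)))
      (Set.Ici 0) t) :
    (∀ t ≥ (0 : ℝ), ∀ a : Fin n, (∑ i, r t (i, a)) = 0) ∧
    (∀ ρ > Lam * δ / lamG, ∃ Tρ ≥ (0 : ℝ), ∀ t ≥ Tρ, euclNorm (r t) ≤ ρ) := by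
  have hri : ∀ t ≥ (0 : ℝ), ∀ p, HasDerivWithinAt (fun s => r s p) _ (Set.Ici 0) t :=
    fun t ht => hasDerivWithinAt_pi.1 (hr t ht)
  have hsum : ∀ t ≥ (0 : ℝ), ∀ a : Fin n, (∑ i, r t (i, a)) = 0 := by
    intro t ht a
    have hderiv : ∀ s ≥ (0 : ℝ),
        HasDerivWithinAt (fun s => ∑ i, r s (i, a)) 0 (Set.Ici 0) s := by
      intro s hs
      refine (HasDerivWithinAt.fun_sum fun i _ => hri s hs (i, a)).congr_deriv ?_
      simp only [Pi.add_apply, Pi.neg_apply, Pi.smul_apply, smul_eq_mul,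
        kronecker_one_mulVec_apply, Finset.sum_add_distrib, Finset.sum_neg_distrib,
        ← Finset.mul_sum, sum_mulVec_eq_zero_of_isSymm hsym hL1]
      simp
    have h0 : ∑ i, r 0 (i, a) = 0 := by simp [hr0]
    have hle := antitoneOn_Ici_of_hasDerivWithinAt_nonpos hderiv (fun _ _ => le_rfl)
      Set.self_mem_Ici ht ht
    have hge := antitoneOn_Ici_of_hasDerivWithinAt_nonpos (fun s hs => (hderiv s hs).neg)
      (fun _ _ => by simp) Set.self_mem_Ici ht ht
    simp only [Pi.neg_apply] at hle hge
    linarith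
  refine ⟨hsum, fun ρ hρ => ⟨0, le_rfl, fun t ht => ?_⟩⟩
  have hδ : 0 ≤ δ := (euclNorm_nonneg _).trans (hdbound 0 le_rfl)
  have hc : 0 ≤ Lam * δ / lamG := by positivity
  have hV : ∀ s ≥ (0 : ℝ), HasDerivWithinAt (fun s => ∑ p, r s p ^ 2) _ (Set.Ici 0) s :=
    fun s hs => HasDerivWithinAt.fun_sum fun p _ => (hri s hs p).pow 2
  refine le_trans (Real.sqrt_le_iff.2 ⟨hc, ?_⟩) hρ.le
  refine le_of_hasDerivWithinAt_le_neg_mul_sub (μ := k * lamG)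
    (by simpa [hr0] using sq_nonneg (Lam * δ / lamG)) hV (fun s hs => ?_) ht
  have hgap' := le_dotProduct_kronecker_one_mulVec hgap (r s) (hsum s hs)
  have hop' := sum_sq_kronecker_one_mulVec_le hop (d s)
  have hd : ∑ p, d s p ^ 2 ≤ δ ^ 2 := by
    rw [← euclNorm_sq]
    exact pow_le_pow_left₀ (euclNorm_nonneg _) (hdbound s hs) 2
  set x := (L ⊗ₖ (1 : Matrix (Fin n) (Fin n) ℝ)).mulVec (r s)
  set y := (L ⊗ₖ (1 : Matrix (Fin n) (Fin n) ℝ)).mulVec (d s)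
  have hy : ∑ p, y p ^ 2 ≤ Lam ^ 2 * δ ^ 2 := hop'.trans (by gcongr)
  have hyoung : 2 * ∑ p, r s p * y p ≤ lamG * ∑ p, r s p ^ 2 + (∑ p, y p ^ 2) / lamG := by
    rw [Finset.mul_sum, Finset.mul_sum, Finset.sum_div, ← Finset.sum_add_distrib]
    refine Finset.sum_le_sum fun p _ => ?_
    have h : lamG * r s p ^ 2 + y p ^ 2 / lamG - 2 * (r s p * y p)
        = (lamG * r s p - y p) ^ 2 / lamG := by field_simp; ring
    have : 0 ≤ (lamG * r s p - y p) ^ 2 / lamG := by positivity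
    linarith
  have hydiv : (∑ p, y p ^ 2) / lamG ≤ lamG * (Lam * δ / lamG) ^ 2 := by
    have h : lamG * (Lam * δ / lamG) ^ 2 = Lam ^ 2 * δ ^ 2 / lamG := by field_simp
    rw [h]
    gcongr
  calc _ = k * (2 * ∑ p, r s p * y p - 2 * ∑ p, r s p * x p) := by
        simp only [Pi.add_apply, Pi.neg_apply, Pi.smul_apply, smul_eq_mul, Finset.mul_sum,
          ← Finset.sum_sub_distrib]
        refine Finset.sum_congr rfl fun p _ => ?_
        push_cast
        ring
    _ ≤ k * (-lamG * (∑ p, r s p ^ 2 - (Lam * δ / lamG) ^ 2)) := by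
        gcongr
        linarith
    _ = _ := by ring
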